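/- arXiv:2108.00307 — 2 statements merged into one kernel-verified Lean document; each statement's English description precedes it below -/
import Mathlib

section
/- Let p ≥ 2 be an integer, d = 1, A ∈ ℂ and ω > 0. Then for all n, j ∈ ℕ, c(A,ω)_{n,j} = (A^n / ω^{2(n−1)/(p−1)}) · c(1,1)_{n,j}, where ω^{2(n−1)/(p−1)} denotes the real power of the positive real ω. (Geometric scaling of the coefficients for monochromatic initial data.) -/
open scoped BigOperators ENNReal

noncomputable section

/-- Cauchy product of doubly indexed sequences (`d = 1`):
`(a*b)_{n,j} = ∑_{n₁+n₂=n} ∑_{j₁+j₂=j} a_{n₁,j₁} b_{n₂,j₂}`. -/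
def conv2 (a b : ℕ → ℕ → ℂ) : ℕ → ℕ → ℂ :=
  fun n j => ∑ k ∈ Finset.range (n + 1), ∑ l ∈ Finset.range (j + 1),
    a k l * b (n - k) (j - l)

/-- `cpow2 a p` is the `p`-fold Cauchy product `a^p`
(with `a^0` the convolution identity). -/
def cpow2 (a : ℕ → ℕ → ℂ) : ℕ → ℕ → ℕ → ℂ
  | 0 => fun n j => if n = 0 ∧ j = 0 then 1 else 0
  | (k + 1) => conv2 a (cpow2 a k)

/-- Membership in `𝒳`: `c_{n,j} ≠ 0` only if `1 ≤ n` and `n ≤ j ≤ n²`. -/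
def memX (c : ℕ → ℕ → ℂ) : Prop :=
  ∀ n j, c n j ≠ 0 → 1 ≤ n ∧ n ≤ j ∧ j ≤ n ^ 2

/-- The recursion (FF) with data `(p, ω, φ)`: for every `n ≥ 1`,
`c_{n,j} = (c^p)_{n,j}/(ω²(n²−j))` for `n ≤ j < n²`, and
`c_{n,n²} = φ_n − ∑_{n ≤ k < n²} (c^p)_{n,k}/(ω²(n²−k))`. -/
def FF (p : ℕ) (ω : ℝ) (φ : ℕ → ℂ) (c : ℕ → ℕ → ℂ) : Prop :=
  ∀ n, 1 ≤ n →
    (∀ j, n ≤ j → j < n ^ 2 →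
      c n j = cpow2 c p n j / ((ω ^ 2 * ((n ^ 2 : ℝ) - (j : ℝ)) : ℝ) : ℂ)) ∧
    c n (n ^ 2) = φ n - ∑ k ∈ Finset.Ico n (n ^ 2),
      cpow2 c p n k / ((ω ^ 2 * ((n ^ 2 : ℝ) - (k : ℝ)) : ℝ) : ℂ)

/-- Monochromatic initial data: `φ₁ = A` and `φ_n = 0` for `n ≠ 1`. -/
def mono (A : ℂ) : ℕ → ℂ := fun n => if n = 1 then A else 0

theorem cpow2_scale (c ct : ℕ → ℕ → ℂ) (s μ : ℂ) (N : ℕ)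
    (h : ∀ m, m < N → ∀ l, c m l = s * μ ^ m * ct m l) (k : ℕ) :
    ∀ m, m < N → ∀ l, cpow2 c k m l = s ^ k * μ ^ m * cpow2 ct k m l := by
  induction k with
  | zero =>
    intro m _ l
    simp only [cpow2]
    split_ifs with h0
    · simp [h0.1]
    · simp
  | succ k ih =>
    intro m hm l
    simp only [cpow2, conv2, Finset.mul_sum]
    refine Finset.sum_congr rfl fun a ha => Finset.sum_congr rfl fun b _ => ?_
    have ha' : a ≤ m := by simpa [Nat.lt_succ_iff] using ha
    rw [h a (by omega), ih (m - a) (by omega)]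
    have : μ ^ m = μ ^ a * μ ^ (m - a) := by rw [← pow_add]; congr 1; omega
    rw [this]; ring

theorem cpow2_zero_left (c : ℕ → ℕ → ℂ) (h : ∀ l, c 0 l = 0) (k l : ℕ) :
    cpow2 c (k + 1) 0 l = 0 := by
  simp [cpow2, conv2, h]

theorem cpow2_scale_top (c ct : ℕ → ℕ → ℂ) (s μ : ℂ) (N : ℕ)
    (h0 : ∀ l, c 0 l = 0) (h0' : ∀ l, ct 0 l = 0)
    (h : ∀ m, m < N → ∀ l, c m l = s * μ ^ m * ct m l) (k l : ℕ) :
    cpow2 c (k + 2) N l = s ^ (k + 2) * μ ^ N * cpow2 ct (k + 2) N l := by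
  change conv2 c (cpow2 c (k + 1)) N l =
    s ^ (k + 2) * μ ^ N * conv2 ct (cpow2 ct (k + 1)) N l
  simp only [conv2, Finset.mul_sum]
  refine Finset.sum_congr rfl fun a ha => Finset.sum_congr rfl fun b _ => ?_
  have ha' : a ≤ N := by simpa [Nat.lt_succ_iff] using ha
  rcases Nat.eq_zero_or_pos a with rfl | hpos
  · simp [h0, h0']
  rcases Nat.eq_or_lt_of_le ha' with rfl | hlt
  · simp [cpow2_zero_left _ h0, cpow2_zero_left _ h0']
  rw [h a hlt, cpow2_scale c ct s μ N h (k + 1) (N - a) (by omega)]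
  have : μ ^ N = μ ^ a * μ ^ (N - a) := by rw [← pow_add]; congr 1; omega
  rw [this]; ring

/-- Geometric scaling of the coefficients for monochromatic initial data:
`c(A,ω)_{n,j} = (A^n / ω^{2(n−1)/(p−1)}) ⬝ c(1,1)_{n,j}`, where `c(A,ω)` is the unique
element of `𝒳` satisfying (FF) with `φ₁ = A`, `φ_n = 0` otherwise. -/
theorem stmt6 (p : ℕ) (hp : 2 ≤ p) (A : ℂ) (ω : ℝ) (hω : 0 < ω)
    (c : ℕ → ℕ → ℂ) (hcX : memX c) (hcFF : FF p ω (mono A) c)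
    (ct : ℕ → ℕ → ℂ) (hctX : memX ct) (hctFF : FF p 1 (mono 1) ct) :
    ∀ n j : ℕ,
      c n j = (A ^ n / ((ω ^ ((2 * ((n : ℝ) - 1)) / ((p : ℝ) - 1)) : ℝ) : ℂ)) * ct n j := by
  have h0 : ∀ l, c 0 l = 0 := fun l => by
    by_contra hne
    have := (hcX 0 l hne).1
    omega
  have h0' : ∀ l, ct 0 l = 0 := fun l => by
    by_contra hne
    have := (hctX 0 l hne).1
    omega
  obtain ⟨q, rfl⟩ : ∃ q, p = q + 2 := ⟨p - 2, by omega⟩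
  have hq : (0 : ℝ) < (q : ℝ) + 1 := by positivity
  have hpq : ((q + 2 : ℕ) : ℝ) - 1 = (q : ℝ) + 1 := by push_cast; ring
  rw [hpq]
  obtain ⟨s, hs⟩ : ∃ s : ℝ, s = ω ^ (2 / ((q : ℝ) + 1)) := ⟨_, rfl⟩
  have hspos : 0 < s := hs ▸ Real.rpow_pos_of_pos hω _
  have hsC : (s : ℂ) ≠ 0 := by exact_mod_cast hspos.ne'
  have hsq : s ^ (q + 1) = ω ^ 2 := by
    rw [hs, ← Real.rpow_natCast, ← Real.rpow_mul hω.le, ← Real.rpow_natCast]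
    congr 1
    push_cast
    field_simp
  have hfac : ∀ n : ℕ, A ^ n / ((ω ^ ((2 * ((n : ℝ) - 1)) / ((q : ℝ) + 1)) : ℝ) : ℂ)
      = s * (A / s) ^ n := by
    intro n
    have : ω ^ ((2 * ((n : ℝ) - 1)) / ((q : ℝ) + 1)) = s ^ n / s := by
      rw [hs, ← Real.rpow_natCast, ← Real.rpow_mul hω.le, ← Real.rpow_sub hω]
      congr 1
      field_simp
    rw [this]
    push_cast
    rw [div_pow]
    field_simp
  intro n
  induction n using Nat.strong_induction_on with
  | _ n ih =>
  intro j
  rw [hfac]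
  rcases Nat.eq_zero_or_pos n with rfl | hn
  · simp [h0, h0']
  have hpow := cpow2_scale_top c ct s (A / s) n h0 h0'
    (fun m hm l => by rw [ih m hm l, hfac]) q
  have hterm : ∀ k, cpow2 c (q + 2) n k / ((ω ^ 2 * ((n ^ 2 : ℝ) - (k : ℝ)) : ℝ) : ℂ)
      = s * (A / s) ^ n *
        (cpow2 ct (q + 2) n k / (((1 : ℝ) ^ 2 * ((n ^ 2 : ℝ) - (k : ℝ)) : ℝ) : ℂ)) := by
    intro k
    rw [hpow, ← hsq, one_pow, one_mul, Complex.ofReal_mul, Complex.ofReal_pow,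
      pow_succ (s : ℂ) (q + 1)]
    have hsp : (s : ℂ) ^ (q + 1) ≠ 0 := pow_ne_zero _ hsC
    rw [show (s : ℂ) ^ (q + 1) * s * (A / s) ^ n * cpow2 ct (q + 2) n k
      = (s : ℂ) ^ (q + 1) * (s * (A / s) ^ n * cpow2 ct (q + 2) n k) by ring,
      mul_div_mul_left _ _ hsp, mul_div_assoc]
  by_cases hj : n ≤ j ∧ j ≤ n ^ 2
  · rcases Nat.eq_or_lt_of_le hj.2 with rfl | hlt
    · rw [(hcFF n hn).2, (hctFF n hn).2, mul_sub, Finset.mul_sum]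
      congr 1
      · by_cases h1 : n = 1
        · subst h1
          simp [mono]
          field_simp
        · simp [mono, h1]
      · exact Finset.sum_congr rfl fun k _ => hterm k
    · rw [(hcFF n hn).1 j hj.1 hlt, (hctFF n hn).1 j hj.1 hlt, hterm]
  · have e1 : c n j = 0 := by
      by_contra hne
      exact hj (hcX n j hne).2
    have e2 : ct n j = 0 := by
      by_contra hne
      exact hj (hctX n j hne).2
    rw [e1, e2, mul_zero]
end
end

section
/- Let p = 2, d = 1, and let c̃ = c(1,1). Then for every n ≥ 1 the coefficient c̃_{n,n} is a positive real number and satisfies the lower bound c̃_{n,n} ≥ 6n/6^n. (Here c̃_{1,1} = 1 and, for n ≥ 2, c̃_{n,n} = (1/(n²−n)) Σ_{k=1}^{n−1} c̃_{k,k} c̃_{n−k,n−k}.) -/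
open scoped BigOperators ENNReal

noncomputable section

lemma conv2_one (a : ℕ → ℕ → ℂ) (n j : ℕ) : cpow2 a 1 n j = a n j := by
  show conv2 a (cpow2 a 0) n j = a n j
  unfold conv2
  rw [Finset.sum_eq_single n, Finset.sum_eq_single j]
  · simp [cpow2]
  · intro l hl hne
    have : j - l ≠ 0 := by have := Finset.mem_range.1 hl; omega
    simp [cpow2, this]
  · intro h; simp at h
  · intro k hk hne
    have : n - k ≠ 0 := by have := Finset.mem_range.1 hk; omega
    simp [cpow2, this]
  · intro h; simp at h

lemma diag_sum (c : ℕ → ℕ → ℂ) (hc : memX c) (n : ℕ) :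
    cpow2 c 2 n n = ∑ k ∈ Finset.range (n + 1), c k k * c (n - k) (n - k) := by
  show conv2 c (cpow2 c 1) n n = _
  unfold conv2
  refine Finset.sum_congr rfl fun k hk => ?_
  have hk' := Finset.mem_range.1 hk
  simp only [conv2_one]
  refine Finset.sum_eq_single k ?_ ?_
  · intro l hl hne
    have hl' := Finset.mem_range.1 hl
    by_contra h
    have h1 := hc _ _ (left_ne_zero_of_mul h)
    have h2 := hc _ _ (right_ne_zero_of_mul h)
    omega
  · intro h; exact absurd hk h

lemma sum_sq_aux (x : ℝ) (m : ℕ) : ∑ k ∈ Finset.range (m + 1), (k : ℝ) * (x - k) =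
    x * (m * (m + 1) / 2) - m * (m + 1) * (2 * m + 1) / 6 := by
  induction m with
  | zero => simp
  | succ m ih => rw [Finset.sum_range_succ, ih]; push_cast; ring

lemma diag_main (c : ℕ → ℕ → ℂ) (hc : memX c) (hF : FF 2 1 (mono 1) c) (n : ℕ) :
    c n n = ((c n n).re : ℂ) ∧ (6 * (n : ℝ)) / 6 ^ n ≤ (c n n).re := by
  have h00 : c 0 0 = 0 := by
    by_contra h
    have := hc _ _ h
    omega
  induction n using Nat.strong_induction_on with
  | _ n ih =>
  rcases Nat.lt_or_ge n 2 with hn | hn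
  · interval_cases n
    · simp [h00]
    · have h := (hF 1 le_rfl).2
      have h1 : c 1 1 = 1 := by simpa [mono] using h
      simp [h1]
  · have h := (hF n (by omega)).1 n le_rfl (by nlinarith)
    have hterm : ∀ k ∈ Finset.range (n + 1), c k k * c (n - k) (n - k) =
        (((c k k).re * (c (n - k) (n - k)).re : ℝ) : ℂ) := by
      intro k hk
      have hk' := Finset.mem_range.1 hk
      rcases Nat.eq_zero_or_pos k with rfl | hk0
      · simp [h00]
      · rcases Nat.eq_or_lt_of_le (Nat.lt_succ_iff.1 hk') with rfl | hkn
        · simp [h00]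
        · push_cast
          rw [← (ih k hkn).1, ← (ih (n - k) (by omega)).1]
    have hlow : ∀ k ∈ Finset.range (n + 1), 36 / 6 ^ n * ((k : ℝ) * (n - k)) ≤
        (c k k).re * (c (n - k) (n - k)).re := by
      intro k hk
      have hk' := Finset.mem_range.1 hk
      rcases Nat.eq_zero_or_pos k with rfl | hk0
      · simp [h00]
      · rcases Nat.eq_or_lt_of_le (Nat.lt_succ_iff.1 hk') with rfl | hkn
        · simp [h00]
        · have h1 := (ih k hkn).2
          have h2 := (ih (n - k) (by omega)).2
          have h3 := mul_le_mul h1 h2 (by positivity) (le_trans (by positivity) h1)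
          refine le_trans (le_of_eq ?_) h3
          have e : (6 : ℝ) ^ n = 6 ^ k * 6 ^ (n - k) := by
            rw [← pow_add]; congr 1; omega
          rw [e, Nat.cast_sub hkn.le]
          field_simp
          ring
    rw [diag_sum c hc, Finset.sum_congr rfl hterm, ← Complex.ofReal_sum,
      ← Complex.ofReal_div] at h
    have hs := Finset.sum_le_sum hlow
    rw [← Finset.mul_sum, sum_sq_aux] at hs
    refine ⟨by rw [h, Complex.ofReal_re], ?_⟩
    rw [h, Complex.ofReal_re]
    have hn' : (2 : ℝ) ≤ n := by exact_mod_cast hn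
    have hd : (0 : ℝ) < 1 ^ 2 * ((n : ℝ) ^ 2 - n) := by nlinarith
    rw [le_div_iff₀ hd]
    refine le_trans ?_ hs
    rw [div_mul_eq_mul_div, div_mul_eq_mul_div]
    refine div_le_div_of_nonneg_right ?_ (by positivity)
    nlinarith

/-- For `p = 2`, the diagonal coefficients of `c̃ = c(1,1)` are positive reals
with `c̃_{n,n} ≥ 6n/6^n` for every `n ≥ 1`. -/
theorem stmt8 (ct : ℕ → ℕ → ℂ) (hctX : memX ct) (hctFF : FF 2 1 (mono 1) ct) :
    ∀ n : ℕ, 1 ≤ n →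
      (ct n n).im = 0 ∧ 0 < (ct n n).re ∧ (6 * (n : ℝ)) / 6 ^ n ≤ (ct n n).re := by
  intro n hn
  obtain ⟨h1, h2⟩ := diag_main ct hctX hctFF n
  have hp : (0 : ℝ) < (6 * (n : ℝ)) / 6 ^ n := by
    have : (0 : ℝ) < n := by exact_mod_cast hn
    positivity
  exact ⟨by rw [h1, Complex.ofReal_im], lt_of_lt_of_le hp h2, h2⟩
end
end
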